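/- arXiv:0804.1861 — 7 statements merged into one kernel-verified Lean document; each statement's English description precedes it below -/
import Mathlib

section
/- Let F = x₁³ + x₂³ + x₃³ + x₄³ + x₅³ be the Fermat cubic form, let 1 ≤ i < j ≤ 5, let β ∈ ℂ with β³ = 1, and let p = e_i − β·e_j ∈ ℂ⁵ (where e₁, …, e₅ is the standard basis). Then for every x ∈ ℂ⁵ with x₁³ + x₂³ + x₃³ + x₄³ + x₅³ = 0 and x_i + β²·x_j = 0, and for all s, t ∈ ℂ, one has F(s·p + t·x) = 0. In other words, for each of the 30 points ℂ(e_i − β e_j), the intersection of the Fermat cubic threefold with its tangent hyperplane {x_i + β²x_j = 0} at that point is a cone with vertex that point. -/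
/-- For the Fermat cubic `F = x₁³ + ⋯ + x₅³`, each of the 30 points
`ℂ(e_i − β e_j)` (`1 ≤ i < j ≤ 5`, `β³ = 1`) is the vertex of a cone: the
intersection of `{F = 0}` with its tangent hyperplane `{x_i + β² x_j = 0}` at
that point is a cone with vertex `e_i − β e_j`. -/
theorem fermat_cubic_tangent_sections_are_cones
    (i j : Fin 5) (hij : i < j) (β : ℂ) (hβ : β ^ 3 = 1)
    (x : Fin 5 → ℂ)
    (hx : ∑ k : Fin 5, (x k) ^ 3 = 0)
    (htangent : x i + β ^ 2 * x j = 0)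
    (s t : ℂ) :
    ∑ k : Fin 5,
      (s * (if k = i then 1 else if k = j then -β else 0) + t * x k) ^ 3 = 0 := by
  have hterm : ∀ k : Fin 5,
      (s * (if k = i then 1 else if k = j then -β else 0) + t * x k) ^ 3 =
        t ^ 3 * x k ^ 3
          + (if k = i then s ^ 3 + 3 * s ^ 2 * t * x i + 3 * s * t ^ 2 * x i ^ 2 else 0)
          + (if k = j then
              -β ^ 3 * s ^ 3 + 3 * β ^ 2 * s ^ 2 * t * x j - 3 * β * s * t ^ 2 * x j ^ 2
            else 0) := by
    intro k
    by_cases hki : k = i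
    · subst hki
      simp only [if_true, if_neg hij.ne]
      ring
    · by_cases hkj : k = j
      · subst hkj
        simp only [if_true, if_neg hki]
        ring
      · simp only [if_neg hki, if_neg hkj]
        ring
  simp only [hterm, Finset.sum_add_distrib, ← Finset.mul_sum, hx, Finset.sum_ite_eq',
    Finset.mem_univ, if_true]
  have hxi : x i = -β ^ 2 * x j := by linear_combination htangent
  rw [hxi]
  linear_combination (-s ^ 3 + 3 * s * t ^ 2 * β * x j ^ 2) * hβ
end

section
/- Fix λ ∈ ℂ and let F = x₁³ + x₂³ + x₃³ − 3λx₁x₂x₃ + x₄³ + x₅³ ∈ ℂ[x₁, …, x₅]. Let β ∈ ℂ with β³ = 1. (i) For {i, j, k} = {1, 2, 3} with i < j, set p = e_i − β·e_j; then for every x ∈ ℂ⁵ with F(x) = 0 and x_i + β²·x_j + λβ·x_k = 0, and all s, t ∈ ℂ, one has F(s·p + t·x) = 0. (ii) Set p = e₄ − β·e₅; then for every x ∈ ℂ⁵ with F(x) = 0 and x₄ + β²·x₅ = 0, and all s, t ∈ ℂ, one has F(s·p + t·x) = 0. In other words, each of these 12 points of ℙ⁴ is the vertex of a cone obtained by intersecting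 {F = 0} with its tangent hyperplane at that point. -/
/-- The cubic form `x₁³ + x₂³ + x₃³ − 3λx₁x₂x₃ + x₄³ + x₅³`, as a function on
`ℂ⁵` (indices `0,…,4`). -/
def cubicFlam (lam : ℂ) (x : Fin 5 → ℂ) : ℂ :=
  (x 0) ^ 3 + (x 1) ^ 3 + (x 2) ^ 3 - 3 * lam * (x 0 * x 1 * x 2) + (x 3) ^ 3 + (x 4) ^ 3

/-- An ordered pair `i < j` together with `k` exhausting the first three indices is one of
three triples. -/
theorem triple_cases_of_set_eq {i j k : Fin 5} (hij : i < j)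
    (h : ({i, j, k} : Set (Fin 5)) = {0, 1, 2}) :
    (i = 0 ∧ j = 1 ∧ k = 2) ∨ (i = 0 ∧ j = 2 ∧ k = 1) ∨ (i = 1 ∧ j = 2 ∧ k = 0) := by
  have h' : ({i, j, k} : Finset (Fin 5)) = {0, 1, 2} := by
    rw [← Finset.coe_inj]
    simpa using h
  clear h
  revert i j k
  decide

/-- If the cubic `a³ + b³ + c³ - 3μabc + d` vanishes at a point of the tangent hyperplane at
`(1, -β, 0)`, it vanishes on the line joining the two points; `d` stands for a cubic form in
further variables. -/
theorem cubic_cone_identity {β : ℂ} (hβ : β ^ 3 = 1) {μ a b c d : ℂ}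
    (hF : a ^ 3 + b ^ 3 + c ^ 3 - 3 * μ * (a * b * c) + d = 0)
    (hL : a + β ^ 2 * b + μ * β * c = 0) (s t : ℂ) :
    (s + t * a) ^ 3 + (t * b - s * β) ^ 3 + (t * c) ^ 3
      - 3 * μ * ((s + t * a) * (t * b - s * β) * (t * c)) + t ^ 3 * d = 0 := by
  linear_combination t ^ 3 * hF + 3 * s * t * (s + t * (a - β ^ 2 * b)) * hL
    + (3 * s * t ^ 2 * (β * b ^ 2 + μ * b * c) - s ^ 3) * hβ

/-- For `F = x₁³ + x₂³ + x₃³ − 3λx₁x₂x₃ + x₄³ + x₅³` and `β³ = 1`: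
(i) for `{i,j,k} = {1,2,3}` with `i < j`, the point `e_i − β e_j` is the vertex
of the cone cut out on `{F = 0}` by its tangent hyperplane
`{x_i + β²x_j + λβx_k = 0}` at that point; (ii) the point `e₄ − β e₅` is the
vertex of the cone cut out on `{F = 0}` by its tangent hyperplane
`{x₄ + β²x₅ = 0}`.  (Here coordinates are indexed `0,…,4`.) -/
theorem F_lambda_twelve_cone_vertices (lam β : ℂ) (hβ : β ^ 3 = 1) :
    (∀ i j k : Fin 5, i < j → ({i, j, k} : Set (Fin 5)) = {0, 1, 2} →
      ∀ x : Fin 5 → ℂ, cubicFlam lam x = 0 →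
        x i + β ^ 2 * x j + lam * β * x k = 0 →
        ∀ s t : ℂ, cubicFlam lam
          (fun m => s * (if m = i then 1 else if m = j then -β else 0) + t * x m) = 0) ∧
    (∀ x : Fin 5 → ℂ, cubicFlam lam x = 0 →
      x 3 + β ^ 2 * x 4 = 0 →
      ∀ s t : ℂ, cubicFlam lam
        (fun m => s * (if m = 3 then 1 else if m = 4 then -β else 0) + t * x m) = 0) := by
  constructor
  · intro i j k hij hset x hF hL s t
    unfold cubicFlam at hF ⊢
    rcases triple_cases_of_set_eq hij hset with
      ⟨rfl, rfl, rfl⟩ | ⟨rfl, rfl, rfl⟩ | ⟨rfl, rfl, rfl⟩ <;>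
    · have key := cubic_cone_identity (d := x 3 ^ 3 + x 4 ^ 3) hβ
        (by linear_combination hF) hL s t
      simp only [Fin.reduceEq, if_true, if_false]
      linear_combination key
  · intro x hF hL s t
    unfold cubicFlam at hF ⊢
    have key := cubic_cone_identity (μ := 0) (a := x 3) (b := x 4) (c := 0) hβ
      (d := x 0 ^ 3 + x 1 ^ 3 + x 2 ^ 3 - 3 * lam * (x 0 * x 1 * x 2))
      (by linear_combination hF) (by linear_combination hL) s t
    simp only [Fin.reduceEq, if_true, if_false]
    linear_combination key
end

section
/- Fix λ, μ ∈ ℂ and let F = Σ_{i=1}^{5} x_i³ + λ·(Σ_{i=1}^{5} x_i)·(Σ_{i=1}^{5} x_i²) + μ·(Σ_{i=1}^{5} x_i)³ ∈ ℂ[x₁, …, x₅]. For 1 ≤ i < j ≤ 5 set p_{ij} = e_i − e_j ∈ ℂ⁵. Then for every x ∈ ℂ⁵ with F(x) = 0 and 3(x_i + x_j) + 2λ·(x₁ + x₂ + x₃ + x₄ + x₅) = 0, and for all s, t ∈ ℂ, one has F(s·p_{ij} + t·x) = 0. In other words, each of the 10 points ℂ(e_i − e_j) is the vertex of a cone obtained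 by intersecting {F = 0} with its tangent hyperplane at that point. -/
/-- The cubic form `Σxᵢ³ + λ(Σxᵢ)(Σxᵢ²) + μ(Σxᵢ)³`, as a function on `ℂ⁵`. -/
noncomputable def cubicSym5 (lam mu : ℂ) (x : Fin 5 → ℂ) : ℂ :=
  (∑ i : Fin 5, (x i) ^ 3) + lam * (∑ i : Fin 5, x i) * (∑ i : Fin 5, (x i) ^ 2)
    + mu * (∑ i : Fin 5, x i) ^ 3

/-- Power sums of `s • (e_i - e_j) + t • x`: only the `i` and `j` terms differ from those
of `t • x`. -/
theorem sum_pow_smul_single_sub_single_add {ι R : Type*} [Fintype ι] [DecidableEq ι] [CommRing R]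
    {i j : ι} (hij : i ≠ j) (x : ι → R) (s t : R) (n : ℕ) :
    ∑ m, (s * (if m = i then 1 else if m = j then -1 else 0) + t * x m) ^ n =
      t ^ n * ∑ m, x m ^ n + ((s + t * x i) ^ n - (t * x i) ^ n)
        + ((-s + t * x j) ^ n - (t * x j) ^ n) := by
  have key : ∀ m, (s * (if m = i then 1 else if m = j then -1 else 0) + t * x m) ^ n =
      t ^ n * x m ^ n + (if m = i then (s + t * x i) ^ n - (t * x i) ^ n else 0)
        + (if m = j then (-s + t * x j) ^ n - (t * x j) ^ n else 0) := by
    intro m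
    rcases eq_or_ne m i with rfl | hi
    · simp [hij, mul_pow]
    · rcases eq_or_ne m j with rfl | hj
      · simp [hi, mul_pow]
      · simp [hi, hj, mul_pow]
  simp_rw [key, Finset.sum_add_distrib, ← Finset.mul_sum]
  simp

/-- Expansion of the cubic form along the line through `e_i - e_j` and `x`. -/
theorem cubicSym5_smul_single_sub_single_add (lam mu : ℂ) {i j : Fin 5} (hij : i ≠ j)
    (x : Fin 5 → ℂ) (s t : ℂ) :
    cubicSym5 lam mu
      (fun m => s * (if m = i then 1 else if m = j then -1 else 0) + t * x m) =
      t ^ 3 * cubicSym5 lam mu x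
        + s * t * (s + t * (x i - x j)) * (3 * (x i + x j) + 2 * lam * ∑ k, x k) := by
  have h1 := sum_pow_smul_single_sub_single_add hij x s t 1
  simp only [pow_one] at h1
  simp only [cubicSym5, h1, sum_pow_smul_single_sub_single_add hij x s t]
  ring

/-- For `F = Σxᵢ³ + λ(Σxᵢ)(Σxᵢ²) + μ(Σxᵢ)³` and `1 ≤ i < j ≤ 5`, the point
`p_{ij} = e_i − e_j` is the vertex of a cone: the intersection of `{F = 0}`
with its tangent hyperplane `{3(x_i + x_j) + 2λ(x₁+⋯+x₅) = 0}` at `p_{ij}` is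
a cone with vertex `p_{ij}`. -/
theorem Sigma5_invariant_cubic_cone_vertices
    (lam mu : ℂ) (i j : Fin 5) (hij : i < j)
    (x : Fin 5 → ℂ)
    (hx : cubicSym5 lam mu x = 0)
    (htangent : 3 * (x i + x j) + 2 * lam * (∑ k : Fin 5, x k) = 0)
    (s t : ℂ) :
    cubicSym5 lam mu
      (fun m => s * (if m = i then 1 else if m = j then -1 else 0) + t * x m) = 0 := by
  rw [cubicSym5_smul_single_sub_single_add lam mu hij.ne, hx, htangent]
  ring
end

section
/- Fix λ ∈ ℂ, a linear form l ∈ ℂ[x₃, x₄, x₅], and let F = x₁³ + x₂³ + 3x₁x₂·l(x₃, x₄, x₅) + x₃³ + x₄³ + x₅³ − 3λx₃x₄x₅ ∈ ℂ[x₁, …, x₅]. Let β ∈ ℂ with β³ = 1 and set p = e₁ − β·e₂ ∈ ℂ⁵. Then for every x ∈ ℂ⁵ with F(x) = 0 and x₁ + β²·x₂ − β·l(x₃, x₄, x₅) = 0, and for all s, t ∈ ℂ, one has F(s·p + t·x) = 0. In other words, each of the 3 points ℂ(e₁ − β e₂), β³ = 1, is the vertex of a cone obtained by intersecting {F = 0}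 with its tangent hyperplane at that point. -/
/-- The cubic form `x₁³ + x₂³ + 3x₁x₂·l(x₃,x₄,x₅) + x₃³ + x₄³ + x₅³ − 3λx₃x₄x₅`
as a function on `ℂ⁵` (indices `0,…,4`), where the linear form `l` has
coefficients `c₃, c₄, c₅`. -/
def cubicG332 (lam c3 c4 c5 : ℂ) (x : Fin 5 → ℂ) : ℂ :=
  (x 0) ^ 3 + (x 1) ^ 3 + 3 * (x 0 * x 1) * (c3 * x 2 + c4 * x 3 + c5 * x 4)
    + (x 2) ^ 3 + (x 3) ^ 3 + (x 4) ^ 3 - 3 * lam * (x 2 * x 3 * x 4)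

/-- For `F = x₁³ + x₂³ + 3x₁x₂·l(x₃,x₄,x₅) + x₃³ + x₄³ + x₅³ − 3λx₃x₄x₅` and
`β³ = 1`, the point `p = e₁ − β e₂` is the vertex of a cone: the intersection
of `{F = 0}` with its tangent hyperplane `{x₁ + β²x₂ − β·l(x₃,x₄,x₅) = 0}` at
`p` is a cone with vertex `p`.  (Coordinates are indexed `0,…,4`.) -/
theorem G332_invariant_cubic_cone_vertices
    (lam c3 c4 c5 : ℂ) (β : ℂ) (hβ : β ^ 3 = 1)
    (x : Fin 5 → ℂ)
    (hx : cubicG332 lam c3 c4 c5 x = 0)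
    (htangent : x 0 + β ^ 2 * x 1 - β * (c3 * x 2 + c4 * x 3 + c5 * x 4) = 0)
    (s t : ℂ) :
    cubicG332 lam c3 c4 c5
      (fun m => s * (if m = 0 then 1 else if m = 1 then -β else 0) + t * x m) = 0 := by
  simp only [cubicG332, ↓reduceIte, Fin.reduceEq, one_ne_zero] at hx ⊢
  linear_combination t ^ 3 * hx
    + 3 * (s ^ 2 * t + s * t ^ 2 * (x 0 - β ^ 2 * x 1)) * htangent
    + (-s ^ 3 + 3 * s * t ^ 2 *
      (β * x 1 ^ 2 - (c3 * x 2 + c4 * x 3 + c5 * x 4) * x 1)) * hβ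
end

section
/- For every integer n ≥ 2, every group homomorphism φ : G(3, 3, n) → ℂ* is either the trivial homomorphism or the determinant: either φ(g) = 1 for all g ∈ G(3, 3, n), or φ(g) = det(g) for all g ∈ G(3, 3, n). -/
open Matrix

/-- `G(m, p, n)`: the subgroup of `GL(n, ℂ)` generated by the permutation
matrices together with the diagonal matrices `D` whose diagonal entries are
`m`-th roots of unity and which satisfy `det(D)^(m/p) = 1`. -/
def ShephardToddG (m p n : ℕ) : Subgroup (GL (Fin n) ℂ) :=
  Subgroup.closure
    ({g | ∃ σ : Equiv.Perm (Fin n), (g : Matrix (Fin n) (Fin n) ℂ) = σ.permMatrix ℂ} ∪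
     {g | ∃ d : Fin n → ℂ, (∀ i, d i ^ m = 1) ∧
        (Matrix.diagonal d).det ^ (m / p) = 1 ∧
        (g : Matrix (Fin n) (Fin n) ℂ) = Matrix.diagonal d})

namespace Matrix

variable {ι : Type*} [Fintype ι] [DecidableEq ι] {R : Type*} [CommRing R]

/-- The homomorphism sending `σ` to the invertible permutation matrix of `σ⁻¹`. -/
def permGL : Equiv.Perm ι →* GL ι R :=
  (permMatrixHom : Equiv.Perm ι →* Matrix ι ι R).toHomUnits

@[simp]
lemma coe_permGL (σ : Equiv.Perm ι) :
    ((permGL σ : GL ι R) : Matrix ι ι R) = σ⁻¹.permMatrix R := rfl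

/-- The homomorphism sending a tuple of units to the invertible diagonal matrix. -/
def diagonalGL : (ι → Rˣ) →* GL ι R :=
  (Units.map (diagonalRingHom ι R : (ι → R) →* Matrix ι ι R)).comp
    (MulEquiv.piUnits (M := fun _ : ι => R)).symm.toMonoidHom

@[simp]
lemma coe_diagonalGL (d : ι → Rˣ) :
    ((diagonalGL d : GL ι R) : Matrix ι ι R) = diagonal fun i => (d i : R) := rfl

lemma permGL_mul_diagonalGL_mul_inv (σ : Equiv.Perm ι) (d : ι → Rˣ) :
    permGL σ * diagonalGL d * (permGL σ)⁻¹ = diagonalGL (d ∘ σ.symm) := by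
  rw [mul_inv_eq_iff_eq_mul]
  ext i j
  simp only [Units.val_mul, coe_permGL, coe_diagonalGL, mul_diagonal, diagonal_mul,
    PEquiv.toMatrix_apply, Equiv.toPEquiv_apply, Function.comp_apply]
  by_cases h : σ.symm i = j
  · subst h
    simp [Equiv.Perm.inv_def]
  · simp [Equiv.Perm.inv_def, h]

end Matrix

/-- A linear character of a finite symmetric group is trivial or the sign. -/
lemma Equiv.Perm.hom_units_trivial_or_sign {α R : Type*} [Fintype α] [DecidableEq α]
    [CommRing R] [IsDomain R] (f : Equiv.Perm α →* Rˣ) :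
    (∀ σ, f σ = 1) ∨ ∀ σ, (f σ : R) = (Equiv.Perm.sign σ : ℤ) := by
  by_cases h : ∀ x y : α, x ≠ y → f (swap x y) = 1
  · left
    intro σ
    induction σ using Equiv.Perm.swap_induction_on with
    | one => exact map_one f
    | swap_mul σ x y hxy ih => rw [map_mul, ih, h x y hxy, mul_one]
  · right
    push Not at h
    obtain ⟨a, b, hab, hne⟩ := h
    have hsq : (f (swap a b) : R) * f (swap a b) = 1 := by
      rw [← Units.val_mul, ← map_mul, swap_mul_self, map_one, Units.val_one]
    have hneg : (f (swap a b) : R) = -1 :=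
      (mul_self_eq_one_iff.mp hsq).resolve_left fun h1 => hne (Units.ext h1)
    intro σ
    induction σ using Equiv.Perm.swap_induction_on with
    | one => simp
    | swap_mul σ x y hxy ih =>
      have hconj : f (swap x y) = f (swap a b) :=
        isConj_iff_eq.mp (f.map_isConj (Equiv.Perm.isConj_swap hxy hab))
      rw [map_mul, Units.val_mul, ih, hconj, hneg, Equiv.Perm.sign_mul,
        Equiv.Perm.sign_swap hxy]
      simp

/-- A tuple with product `1` is a product of tuples with entries `z` and `z⁻¹` at two places. -/
lemma prod_mulSingle_mul_inv_eq {ι C : Type*} [Fintype ι] [DecidableEq ι] [CommGroup C]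
    (d : ι → C) (hd : ∏ i, d i = 1) (j : ι) :
    ∏ i, (Pi.mulSingle i (d i) * (Pi.mulSingle j (d i))⁻¹ : ι → C) = d := by
  have h : ∏ i, (Pi.mulSingle j (d i) : ι → C) = 1 :=
    (map_prod (MonoidHom.mulSingle (fun _ : ι => C) j) d _).symm.trans (by rw [hd, map_one])
  rw [Finset.prod_mul_distrib, Finset.univ_prod_mulSingle, Finset.prod_inv_distrib, h, inv_one,
    mul_one]

namespace ShephardToddG

lemma permGL_mem (m p : ℕ) {n : ℕ} (σ : Equiv.Perm (Fin n)) :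
    permGL σ ∈ ShephardToddG m p n :=
  Subgroup.subset_closure (Or.inl ⟨σ⁻¹, rfl⟩)

lemma diagonalGL_mem {m n : ℕ} {d : Fin n → ℂˣ} (hd : ∀ i, d i ^ m = 1)
    (hprod : ∏ i, d i = 1) : diagonalGL d ∈ ShephardToddG m m n := by
  refine Subgroup.subset_closure (Or.inr ⟨fun i => d i, fun i => ?_, ?_, rfl⟩)
  · rw [← Units.val_pow_eq_pow_val, hd, Units.val_one]
  · rw [det_diagonal, ← Units.coe_prod, hprod, Units.val_one, one_pow]

/-- If `m` is odd, then linear characters of `G(m, m, n)` kill the diagonal matrices. -/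
lemma hom_diagonalGL_eq_one {m n : ℕ} {C : Type*} [CommGroup C] (hm : Odd m)
    (φ : ShephardToddG m m n →* C) {d : Fin n → ℂˣ} (hd : ∀ i, d i ^ m = 1)
    (hprod : ∏ i, d i = 1) :
    φ ⟨diagonalGL d, diagonalGL_mem hd hprod⟩ = 1 := by
  have key (i j : Fin n) (z : ℂˣ) (hz : z ^ m = 1) :
      (Pi.mulSingle i z * (Pi.mulSingle j z)⁻¹ : Fin n → ℂˣ) ∈
        (φ.ker.map (ShephardToddG m m n).subtype).comap diagonalGL := by
    obtain rfl | hij := eq_or_ne i j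
    · rw [mul_inv_cancel]
      exact one_mem _
    set e : Fin n → ℂˣ := Pi.mulSingle i z * (Pi.mulSingle j z)⁻¹ with he
    have hpow : e ^ m = 1 := by
      rw [he, mul_pow, inv_pow, ← Pi.mulSingle_pow, ← Pi.mulSingle_pow, hz]
      simp
    have hmem : diagonalGL e ∈ ShephardToddG m m n :=
      diagonalGL_mem (fun k => congrFun hpow k) (by simp [he, Finset.prod_mul_distrib])
    have hswap : e ∘ (Equiv.swap i j).symm = e⁻¹ := by
      ext k
      rcases eq_or_ne k i with rfl | hki
      · simp [he, hij, hij.symm]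
      rcases eq_or_ne k j with rfl | hkj
      · simp [he, hij, hij.symm]
      · simp [he, hki, hkj, Equiv.swap_apply_of_ne_of_ne hki hkj]
    let g : ShephardToddG m m n := ⟨diagonalGL e, hmem⟩
    let s : ShephardToddG m m n := ⟨permGL (Equiv.swap i j), permGL_mem m m _⟩
    have hconj : s * g * s⁻¹ = g⁻¹ := by
      have h := permGL_mul_diagonalGL_mul_inv (Equiv.swap i j) e
      rw [hswap, map_inv] at h
      exact Subtype.ext h
    have hgm : g ^ m = 1 := by
      ext1
      simpa [g, hpow] using (map_pow diagonalGL e m).symm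
    have hinv : φ g = (φ g)⁻¹ := by
      rw [← map_inv, ← hconj, map_mul_inv, map_mul, mul_inv_cancel_comm]
    have hsq : φ g ^ 2 = 1 := by
      rw [pow_two, mul_eq_one_iff_eq_inv]
      exact hinv
    have hφm : φ g ^ m = 1 := by rw [← map_pow, hgm, map_one]
    have hone : φ g = 1 := by
      obtain ⟨k, rfl⟩ := hm
      rwa [pow_succ, pow_mul, hsq, one_pow, one_mul] at hφm
    exact ⟨g, hone, rfl⟩
  rcases isEmpty_or_nonempty (Fin n) with _ | ⟨⟨j⟩⟩
  · convert map_one φ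
    exact Subsingleton.elim _ _
  have hd_mem : d ∈ (φ.ker.map (ShephardToddG m m n).subtype).comap diagonalGL := by
    rw [← prod_mulSingle_mul_inv_eq d hprod j]
    exact Subgroup.prod_mem _ fun i _ => key i j (d i) (hd i)
  obtain ⟨g, hg, hgd⟩ := hd_mem
  convert MonoidHom.mem_ker.mp hg
  exact hgd.symm

/-- Two homomorphisms on `G(m, m, n)` agree if they agree on the permutation matrices and on the
diagonal matrices. -/
lemma hom_ext {m n : ℕ} {C : Type*} [Group C] (hm : 0 < m) {φ ψ : ShephardToddG m m n →* C}
    (hperm : ∀ σ, φ ⟨permGL σ, permGL_mem m m σ⟩ = ψ ⟨permGL σ, permGL_mem m m σ⟩)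
    (hdiag : ∀ (d : Fin n → ℂˣ) (hd : ∀ i, d i ^ m = 1) (hprod : ∏ i, d i = 1),
      φ ⟨diagonalGL d, diagonalGL_mem hd hprod⟩ =
        ψ ⟨diagonalGL d, diagonalGL_mem hd hprod⟩) : φ = ψ := by
  ext ⟨g, hg⟩
  induction hg using Subgroup.closure_induction with
  | mem g hg =>
    rcases hg with ⟨σ, hσ⟩ | ⟨d, hd, hdet, hgd⟩
    · obtain rfl : g = permGL σ⁻¹ := by
        refine Units.ext ?_
        rw [hσ, coe_permGL, inv_inv]
      exact hperm σ⁻¹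
    · have hd0 (i : Fin n) : d i ≠ 0 := fun h => by simpa [h, hm.ne'] using hd i
      obtain ⟨u, rfl⟩ : ∃ u : Fin n → ℂˣ, d = fun i => (u i : ℂ) :=
        ⟨fun i => Units.mk0 (d i) (hd0 i), rfl⟩
      obtain rfl : g = diagonalGL u := Units.ext hgd
      refine hdiag u (fun i => Units.ext (by simpa using hd i)) (Units.ext ?_)
      simpa [Nat.div_self hm, det_diagonal] using hdet
  | one => exact (map_one φ).trans (map_one ψ).symm
  | mul x y hx hy ihx ihy =>
    exact (map_mul φ ⟨x, hx⟩ ⟨y, hy⟩).trans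
      ((congrArg₂ (· * ·) ihx ihy).trans (map_mul ψ ⟨x, hx⟩ ⟨y, hy⟩).symm)
  | inv x hx ih =>
    exact (map_inv φ ⟨x, hx⟩).trans ((congrArg (·⁻¹) ih).trans (map_inv ψ ⟨x, hx⟩).symm)

end ShephardToddG

/-- For every integer `n ≥ 2`, every group homomorphism
`φ : G(3, 3, n) → ℂ*` is either trivial or the determinant. -/
theorem hom_G33n_to_units_trivial_or_det (n : ℕ) (hn : 2 ≤ n)
    (φ : (ShephardToddG 3 3 n) →* ℂˣ) :
    (∀ g : ShephardToddG 3 3 n, φ g = 1) ∨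
    (∀ g : ShephardToddG 3 3 n, (φ g : ℂ) = ((g : GL (Fin n) ℂ) : Matrix (Fin n) (Fin n) ℂ).det) := by
  have hdiag (d : Fin n → ℂˣ) (hd : ∀ i, d i ^ 3 = 1) (hprod : ∏ i, d i = 1) :
      φ ⟨diagonalGL d, ShephardToddG.diagonalGL_mem hd hprod⟩ = 1 :=
    ShephardToddG.hom_diagonalGL_eq_one (by decide) φ hd hprod
  rcases Equiv.Perm.hom_units_trivial_or_sign
      (φ.comp (permGL.codRestrict (ShephardToddG 3 3 n) (ShephardToddG.permGL_mem 3 3)))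
    with htriv | hsign
  · left
    have h : φ = 1 := ShephardToddG.hom_ext three_pos htriv hdiag
    exact fun g => by rw [h, MonoidHom.one_apply]
  · right
    have h : φ = GeneralLinearGroup.det.comp (ShephardToddG 3 3 n).subtype := by
      refine ShephardToddG.hom_ext three_pos (fun σ => Units.ext ((hsign σ).trans ?_))
        fun d hd hprod => (hdiag d hd hprod).trans (Units.ext ?_)
      · simp
      · simp [det_diagonal, ← Units.coe_prod, hprod]
    exact fun g => by rw [h]; rfl
end

section
/- Let m ∈ {1, 3} and let n ≥ 2 be an integer. There exists a nonzero polynomial P ∈ ℂ[x₁, …, xₙ] of total degree at most 3 satisfying P(g·x) = det(g)·P(x) for all g ∈ G(m, m, n) (an anti-invariant of degree ≤ 3) if and only if (m, n) ∈ {(1, 2), (3, 2), (1, 3)}. In other words, the only groups among the G(m, m, n) with m ∈ {1, 3}, n ≥ 2 possessing an anti-invariant polynomial of degree ≤ 3 are G(1,1,2), G(3,3,2) and G(1,1,3). -/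
open Matrix

/-- The diagonal substitution `X i ↦ c i * X i` multiplies the coefficient of `X ^ e`
by `∏ i, c i ^ e i`. -/
lemma MvPolynomial.coeff_bind₁_C_mul_X {σ R : Type*} [Fintype σ] [CommSemiring R]
    (c : σ → R) (P : MvPolynomial σ R) (e : σ →₀ ℕ) :
    (MvPolynomial.bind₁ (fun i => MvPolynomial.C (c i) * MvPolynomial.X i) P).coeff e =
      (∏ i, c i ^ e i) * P.coeff e := by
  classical
  induction P using MvPolynomial.induction_on' with
  | monomial u a =>
    have h : MvPolynomial.bind₁ (fun i => MvPolynomial.C (c i) * MvPolynomial.X i)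
        (MvPolynomial.monomial u a) = MvPolynomial.monomial u ((∏ i, c i ^ u i) * a) := by
      rw [MvPolynomial.bind₁_monomial, ← Finsupp.prod, Finsupp.prod_fintype _ _ (by simp),
        MvPolynomial.monomial_eq, Finsupp.prod_fintype _ _ (by simp)]
      simp only [mul_pow, Finset.prod_mul_distrib, map_mul, map_prod, map_pow]
      ring
    rw [h, MvPolynomial.coeff_monomial, MvPolynomial.coeff_monomial]
    split_ifs with hu
    · rw [hu]
    · simp
  | add p q hp hq => rw [map_add, MvPolynomial.coeff_add, hp, hq, MvPolynomial.coeff_add, mul_add]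

/-- Exponents occurring in a polynomial that changes sign under all transpositions of the
variables are pairwise distinct. -/
lemma MvPolynomial.injective_of_coeff_ne_zero_of_rename_swap {n : ℕ}
    {P : MvPolynomial (Fin n) ℂ}
    (hP : ∀ i j, i ≠ j → MvPolynomial.rename (Equiv.swap i j) P = -P)
    {e : Fin n →₀ ℕ} (he : P.coeff e ≠ 0) : Function.Injective e := by
  intro i j hij
  by_contra hne
  have hd : e.mapDomain (Equiv.swap i j) = e := by
    ext k
    rw [← Finsupp.equivMapDomain_eq_mapDomain, Finsupp.equivMapDomain_apply, Equiv.symm_swap,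
      Equiv.swap_apply_def]
    split_ifs with h1 h2
    · rw [h1, hij]
    · rw [h2, hij]
    · rfl
  have h := MvPolynomial.coeff_rename_mapDomain _ (Equiv.swap i j).injective P e
  rw [hd, hP i j hne, MvPolynomial.coeff_neg] at h
  exact he (self_eq_neg.mp h.symm)

/-- Four pairwise distinct natural numbers have sum at least `6`. -/
lemma Function.Injective.six_le_sum {n : ℕ} (hn : 4 ≤ n) {e : Fin n → ℕ}
    (he : Function.Injective e) : 6 ≤ ∑ i, e i := by
  have h : ∑ i : Fin 4, e (Fin.castLE hn i) ≤ ∑ i, e i := by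
    exact (Finset.sum_map Finset.univ (Fin.castLEEmb hn) e).symm.trans_le
      (Finset.sum_le_sum_of_subset (Finset.subset_univ _))
  have hi : Function.Injective fun i : Fin 4 => e (Fin.castLE hn i) :=
    he.comp (Fin.castLE_injective hn)
  have hne : ∀ i j : Fin 4, i ≠ j → e (Fin.castLE hn i) ≠ e (Fin.castLE hn j) :=
    fun i j hij => hi.ne hij
  have h01 := hne 0 1 (by decide)
  have h02 := hne 0 2 (by decide)
  have h03 := hne 0 3 (by decide)
  have h12 := hne 1 2 (by decide)
  have h13 := hne 1 3 (by decide)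
  have h23 := hne 2 3 (by decide)
  rw [Fin.sum_univ_four] at h
  omega

lemma ShephardToddG.exists_perm (m p : ℕ) {n : ℕ} (σ : Equiv.Perm (Fin n)) :
    ∃ g ∈ ShephardToddG m p n, (g : Matrix (Fin n) (Fin n) ℂ) = σ.permMatrix ℂ := by
  have h : (σ.permMatrix ℂ).det ≠ 0 := by
    rw [Matrix.det_permutation]
    exact_mod_cast (Equiv.Perm.sign σ).ne_zero
  exact ⟨Matrix.GeneralLinearGroup.mkOfDetNeZero _ h,
    Subgroup.subset_closure (Or.inl ⟨σ, rfl⟩), rfl⟩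

lemma ShephardToddG.exists_diagonal {m n : ℕ} {d : Fin n → ℂ}
    (hd : ∀ i, d i ^ m = 1) (hdet : ∏ i, d i = 1) :
    ∃ g ∈ ShephardToddG m m n, (g : Matrix (Fin n) (Fin n) ℂ) = Matrix.diagonal d := by
  have h : (Matrix.diagonal d).det = 1 := by rw [Matrix.det_diagonal, hdet]
  exact ⟨Matrix.GeneralLinearGroup.mkOfDetNeZero _ (h ▸ one_ne_zero),
    Subgroup.subset_closure (Or.inr ⟨d, hd, by rw [h, one_pow], rfl⟩), rfl⟩

/-- The Vandermonde determinant in the `m`-th powers of the variables. -/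
noncomputable def powVandermonde (m n : ℕ) : MvPolynomial (Fin n) ℂ :=
  (Matrix.vandermonde fun i => (MvPolynomial.X i : MvPolynomial (Fin n) ℂ) ^ m).det

lemma eval_powVandermonde (m n : ℕ) (x : Fin n → ℂ) :
    MvPolynomial.eval x (powVandermonde m n) = (Matrix.vandermonde fun i => x i ^ m).det := by
  simp [powVandermonde, Matrix.det_vandermonde]

lemma powVandermonde_ne_zero {m : ℕ} (hm : m ≠ 0) (n : ℕ) : powVandermonde m n ≠ 0 := by
  rw [powVandermonde, Matrix.det_vandermonde_ne_zero_iff]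
  intro i j hij
  simp only [MvPolynomial.X_pow_eq_monomial] at hij
  have h := MvPolynomial.monomial_left_injective (one_ne_zero (α := ℂ)) hij
  exact Finsupp.single_left_injective hm h

lemma totalDegree_powVandermonde_le (m n : ℕ) :
    (powVandermonde m n).totalDegree ≤ ∑ i : Fin n, ∑ _j ∈ Finset.Ioi i, m := by
  rw [powVandermonde, Matrix.det_vandermonde]
  refine (MvPolynomial.totalDegree_finsetProd _ _).trans (Finset.sum_le_sum fun i _ => ?_)
  refine (MvPolynomial.totalDegree_finsetProd _ _).trans (Finset.sum_le_sum fun j _ => ?_)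
  refine (MvPolynomial.totalDegree_sub _ _).trans ?_
  simp [MvPolynomial.totalDegree_X_pow]

/-- The Vandermonde determinant in the `m`-th powers is an anti-invariant of `G(m, m, n)`. -/
lemma eval_mulVec_powVandermonde {m n : ℕ} (hm : 0 < m) {g : GL (Fin n) ℂ}
    (hg : g ∈ ShephardToddG m m n) (x : Fin n → ℂ) :
    MvPolynomial.eval ((g : Matrix (Fin n) (Fin n) ℂ).mulVec x) (powVandermonde m n) =
      (g : Matrix (Fin n) (Fin n) ℂ).det * MvPolynomial.eval x (powVandermonde m n) := by
  induction hg using Subgroup.closure_induction generalizing x with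
  | mem g hg =>
    rcases hg with ⟨σ, hσ⟩ | ⟨d, hd, hdet, hgd⟩
    · rw [hσ, Matrix.permMatrix_mulVec, Matrix.det_permutation, eval_powVandermonde,
        eval_powVandermonde]
      exact Matrix.det_permute σ (Matrix.vandermonde fun i => x i ^ m)
    · rw [Nat.div_self hm, pow_one] at hdet
      rw [hgd, hdet, eval_powVandermonde, eval_powVandermonde, one_mul]
      simp only [Matrix.mulVec_diagonal, mul_pow, hd, one_mul]
  | one => simp
  | mul a b _ _ ha hb =>
    rw [Units.val_mul, ← Matrix.mulVec_mulVec, ha, hb, Matrix.det_mul, mul_assoc]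
  | inv a _ ha =>
    have h1 : (a : Matrix (Fin n) (Fin n) ℂ) * (a⁻¹ : GL (Fin n) ℂ) = 1 := by
      rw [← Units.val_mul, mul_inv_cancel, Units.val_one]
    have h := ha (((a⁻¹ : GL (Fin n) ℂ) : Matrix (Fin n) (Fin n) ℂ).mulVec x)
    rw [Matrix.mulVec_mulVec, h1, Matrix.one_mulVec] at h
    have h2 := congrArg Matrix.det h1
    rw [Matrix.det_mul, Matrix.det_one] at h2
    rw [h, ← mul_assoc, mul_comm (Matrix.det _) (Matrix.det _), h2, one_mul]

/-- For `m ∈ {1, 3}` and `n ≥ 2`, the group `G(m, m, n)` possesses a nonzero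
anti-invariant polynomial of total degree at most `3` — a `P ∈ ℂ[x₁,…,xₙ]`
with `P(g·x) = det(g)·P(x)` for all `g ∈ G(m, m, n)` — if and only if
`(m, n)` is `(1, 2)`, `(3, 2)` or `(1, 3)`. -/
theorem antiinvariant_degree_le_three_iff (m n : ℕ) (hm : m = 1 ∨ m = 3) (hn : 2 ≤ n) :
    (∃ P : MvPolynomial (Fin n) ℂ, P ≠ 0 ∧ P.totalDegree ≤ 3 ∧
      ∀ g ∈ ShephardToddG m m n, ∀ x : Fin n → ℂ,
        MvPolynomial.eval (((g : GL (Fin n) ℂ) : Matrix (Fin n) (Fin n) ℂ).mulVec x) P =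
          ((g : GL (Fin n) ℂ) : Matrix (Fin n) (Fin n) ℂ).det * MvPolynomial.eval x P) ↔
    ((m, n) = (1, 2) ∨ (m, n) = (3, 2) ∨ (m, n) = (1, 3)) := by
  constructor
  · rintro ⟨P, hP0, hdeg, hP⟩
    have hswap : ∀ i j, i ≠ j → MvPolynomial.rename (Equiv.swap i j) P = -P := by
      intro i j hij
      obtain ⟨g, hg, hgσ⟩ := ShephardToddG.exists_perm m m (Equiv.swap i j)
      refine MvPolynomial.funext fun x => ?_
      have h := hP g hg x
      rw [hgσ, Matrix.permMatrix_mulVec, Matrix.det_permutation,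
        Equiv.Perm.sign_swap hij] at h
      rw [MvPolynomial.eval_rename, h]
      simp
    obtain ⟨e, he⟩ := MvPolynomial.ne_zero_iff.mp hP0
    have hinj := MvPolynomial.injective_of_coeff_ne_zero_of_rename_swap hswap he
    have hsum : ∑ i, e i ≤ 3 := by
      have h := MvPolynomial.le_totalDegree (MvPolynomial.mem_support_iff.mpr he)
      rw [Finsupp.sum_fintype _ _ (by simp)] at h
      exact h.trans hdeg
    have hn4 : n < 4 := by
      by_contra! h
      have := hinj.six_le_sum h
      omega
    rcases hm with rfl | rfl
    · interval_cases n <;> simp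
    · interval_cases n
      · simp
      · exfalso
        obtain ⟨ω, hω⟩ : ∃ ω : ℂ, IsPrimitiveRoot ω 3 :=
          ⟨_, Complex.isPrimitiveRoot_exp 3 (by norm_num)⟩
        have hω3 := hω.pow_eq_one
        obtain ⟨g, hg, hgd⟩ := ShephardToddG.exists_diagonal (m := 3) (d := ![ω, ω ^ 2, 1])
          (by
            intro i
            fin_cases i
            · simpa using hω3
            · change (ω ^ 2) ^ 3 = 1
              rw [pow_right_comm, hω3, one_pow]
            · simp)
          (by simp [Fin.prod_univ_three, ← pow_succ', hω3])
        have hdet : (g : Matrix (Fin 3) (Fin 3) ℂ).det = 1 := by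
          rw [hgd, Matrix.det_diagonal]
          simp [Fin.prod_univ_three, ← pow_succ', hω3]
        have hbind : MvPolynomial.bind₁ (fun i => MvPolynomial.C (![ω, ω ^ 2, 1] i) *
            MvPolynomial.X i) P = P := by
          refine MvPolynomial.funext fun x => ?_
          have h := hP g hg x
          rw [hdet, one_mul, hgd] at h
          rw [← h, MvPolynomial.eval, MvPolynomial.eval₂Hom_bind₁]
          congr 2
          funext i
          simp [Matrix.mulVec_diagonal]
        have hc := MvPolynomial.coeff_bind₁_C_mul_X ![ω, ω ^ 2, 1] P e
        rw [hbind] at hc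
        have hpow : ω ^ (e 0 + 2 * e 1) = 1 := by
          have := mul_right_cancel₀ he ((one_mul _).trans hc)
          simpa [Fin.prod_univ_three, ← pow_mul, ← pow_add] using this.symm
        have hdvd := (hω.pow_eq_one_iff_dvd _).mp hpow
        have h01 := hinj.ne (show (0 : Fin 3) ≠ 1 by decide)
        have h02 := hinj.ne (show (0 : Fin 3) ≠ 2 by decide)
        have h12 := hinj.ne (show (1 : Fin 3) ≠ 2 by decide)
        rw [Fin.sum_univ_three] at hsum
        omega
  · intro h
    have hm0 : 0 < m := by omega
    refine ⟨powVandermonde m n, powVandermonde_ne_zero hm0.ne' n,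
      (totalDegree_powVandermonde_le m n).trans ?_,
      fun g hg x => eval_mulVec_powVandermonde hm0 hg x⟩
    simp only [Prod.mk.injEq] at h
    rcases h with ⟨rfl, rfl⟩ | ⟨rfl, rfl⟩ | ⟨rfl, rfl⟩ <;> decide
end

section
/- Let C ∈ ℂ[x₁, …, x₅] be a homogeneous polynomial of degree 3 which is projectively invariant under G(3, 3, 5), i.e. for every g ∈ G(3, 3, 5) there exists c(g) ∈ ℂ with C(g·x) = c(g)·C(x) identically. Then C is a scalar multiple of the Fermat cubic form: C = a·(x₁³ + x₂³ + x₃³ + x₄³ + x₅³) for some a ∈ ℂ. In particular, up to scalar, the Fermat cubic is the only cubic threefold stable under G(3, 3, 5). -/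
open Matrix MvPolynomial

theorem MvPolynomial.coeff_aeval_C_mul_X {σ R : Type*} [CommSemiring R] (d : σ → R)
    (p : MvPolynomial σ R) (s : σ →₀ ℕ) :
    coeff s (aeval (fun i => MvPolynomial.C (d i) * X i) p) =
      (s.prod fun i k => d i ^ k) * coeff s p := by
  classical
  induction p using MvPolynomial.induction_on' with
  | monomial u a =>
    have h : aeval (fun i => MvPolynomial.C (d i) * X i) (monomial u a) =
        MvPolynomial.C (u.prod fun i k => d i ^ k) * monomial u a := by
      rw [aeval_monomial, monomial_eq (s := u) (a := a)]
      simp only [mul_pow, algebraMap_eq, ← map_pow, Finsupp.prod, map_prod,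
        Finset.prod_mul_distrib]
      ring
    rw [h, coeff_C_mul, coeff_monomial]
    split_ifs with hs
    · rw [hs]
    · simp
  | add p q hp hq => simp only [map_add, coeff_add, hp, hq, mul_add]

/-- The monomials of a semi-invariant of a diagonal matrix are all scaled by the same factor. -/
theorem MvPolynomial.coeff_mul_of_eval_diagonal_mulVec {n : ℕ} {p : MvPolynomial (Fin n) ℂ}
    {d : Fin n → ℂ} {c : ℂ}
    (h : ∀ x : Fin n → ℂ, eval ((Matrix.diagonal d).mulVec x) p = c * eval x p)
    (s : Fin n →₀ ℕ) : (∏ i, d i ^ s i) * coeff s p = c * coeff s p := by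
  have hp : aeval (fun i => MvPolynomial.C (d i) * X i) p = MvPolynomial.C c * p := by
    refine MvPolynomial.funext fun x => ?_
    rw [map_mul, eval_C, ← h x, ← aeval_eq_eval, ← aeval_eq_eval]
    change aeval x (aeval _ p) = aeval _ p
    rw [← AlgHom.comp_apply, comp_aeval]
    congr 2
    ext i
    simp [Matrix.mulVec_diagonal]
  have := coeff_aeval_C_mul_X d p s
  rw [hp, coeff_C_mul, Finsupp.prod_fintype _ _ (by simp)] at this
  exact this.symm

/-- The coefficients of a semi-invariant of a permutation matrix are permuted up to a factor. -/
theorem MvPolynomial.coeff_mapDomain_of_eval_permMatrix_mulVec {n : ℕ}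
    {p : MvPolynomial (Fin n) ℂ} {σ : Equiv.Perm (Fin n)} {c : ℂ}
    (h : ∀ x : Fin n → ℂ, eval ((σ.permMatrix ℂ).mulVec x) p = c * eval x p)
    (s : Fin n →₀ ℕ) : coeff s p = c * coeff (s.mapDomain σ) p := by
  have hp : rename σ p = MvPolynomial.C c * p := by
    refine MvPolynomial.funext fun x => ?_
    rw [map_mul, eval_C, ← h x, eval_rename, Matrix.permMatrix_mulVec]
  rw [← coeff_C_mul, ← hp, coeff_rename_mapDomain _ σ.injective]

theorem exists_coeff_mapDomain_of_projectively_invariant {m p n : ℕ}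
    {P : MvPolynomial (Fin n) ℂ}
    (hinv : ∀ g ∈ ShephardToddG m p n, ∃ c : ℂ, ∀ x : Fin n → ℂ,
      eval (((g : GL (Fin n) ℂ) : Matrix (Fin n) (Fin n) ℂ).mulVec x) P = c * eval x P)
    (σ : Equiv.Perm (Fin n)) :
    ∃ c : ℂ, ∀ s, coeff s P = c * coeff (s.mapDomain σ) P := by
  have hdet : IsUnit (σ.permMatrix ℂ).det := by
    rw [Matrix.det_permutation]; exact (Units.isUnit _).map (Int.castRingHom ℂ)
  obtain ⟨c, hc⟩ := hinv ((σ.permMatrix ℂ).nonsingInvUnit hdet)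
    (Subgroup.subset_closure (Or.inl ⟨σ, rfl⟩))
  exact ⟨c, coeff_mapDomain_of_eval_permMatrix_mulVec hc⟩

theorem exists_prod_pow_mul_coeff_of_projectively_invariant {m p n : ℕ}
    {P : MvPolynomial (Fin n) ℂ}
    (hinv : ∀ g ∈ ShephardToddG m p n, ∃ c : ℂ, ∀ x : Fin n → ℂ,
      eval (((g : GL (Fin n) ℂ) : Matrix (Fin n) (Fin n) ℂ).mulVec x) P = c * eval x P)
    {d : Fin n → ℂ} (hd : ∀ i, d i ^ m = 1) (hprod : ∏ i, d i = 1) :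
    ∃ c : ℂ, ∀ s, (∏ i, d i ^ s i) * coeff s P = c * coeff s P := by
  have hdet : (Matrix.diagonal d).det = 1 := by rw [Matrix.det_diagonal, hprod]
  obtain ⟨c, hc⟩ := hinv ((Matrix.diagonal d).nonsingInvUnit (by simp [hdet]))
    (Subgroup.subset_closure (Or.inr ⟨d, hd, by rw [hdet, one_pow], rfl⟩))
  exact ⟨c, coeff_mul_of_eval_diagonal_mulVec hc⟩

/-- Exponents carrying a nonzero coefficient of a `G(m, p, n)` semi-invariant (`n ≥ 3`) have all
their entries congruent modulo `m`. -/
theorem modEq_of_coeff_ne_zero_of_projectively_invariant {m p n : ℕ} (hm : m ≠ 0)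
    {P : MvPolynomial (Fin n) ℂ}
    (hinv : ∀ g ∈ ShephardToddG m p n, ∃ c : ℂ, ∀ x : Fin n → ℂ,
      eval (((g : GL (Fin n) ℂ) : Matrix (Fin n) (Fin n) ℂ).mulVec x) P = c * eval x P)
    {s : Fin n →₀ ℕ} (hs : coeff s P ≠ 0) {i j k : Fin n}
    (hik : i ≠ k) (hjk : j ≠ k) : s i ≡ s j [MOD m] := by
  obtain ⟨a, ha⟩ := exists_coeff_mapDomain_of_projectively_invariant hinv (Equiv.swap i j)
  have hζ := Complex.isPrimitiveRoot_exp m hm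
  set ζ := Complex.exp (2 * Real.pi * Complex.I / m)
  have hζ0 : ζ ≠ 0 := hζ.ne_zero hm
  set d : Fin n → ℂ := Pi.mulSingle i ζ * Pi.mulSingle k ζ⁻¹
  have hdm : ∀ l, d l ^ m = 1 := by
    have h : d ^ m = 1 := by
      simp only [d, mul_pow, ← Pi.mulSingle_pow, inv_pow, hζ.pow_eq_one, inv_one,
        Pi.mulSingle_one, mul_one]
    exact congrFun h
  have hdprod : ∏ l, d l = 1 := by
    simp [d, Finset.prod_mul_distrib, hζ0]
  have hds (t : Fin n →₀ ℕ) : ∏ l, d l ^ t l = ζ ^ t i * (ζ⁻¹) ^ t k := by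
    simp only [d, Pi.mul_apply, mul_pow, Finset.prod_mul_distrib]
    congr 1
    · rw [Finset.prod_eq_single i (by intro b _ hb; simp [hb]) (by simp)]; simp
    · rw [Finset.prod_eq_single k (by intro b _ hb; simp [hb]) (by simp)]; simp
  obtain ⟨c, hc⟩ := exists_prod_pow_mul_coeff_of_projectively_invariant hinv hdm hdprod
  set t := s.mapDomain (Equiv.swap i j)
  have ht : coeff t P ≠ 0 := fun h => hs (by rw [ha s, h, mul_zero])
  have hti : t i = s j := by
    rw [← Equiv.swap_apply_right i j]; exact Finsupp.mapDomain_apply (Equiv.injective _) _ _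
  have htk : t k = s k := by
    nth_rw 1 [← Equiv.swap_apply_of_ne_of_ne hik.symm hjk.symm]
    exact Finsupp.mapDomain_apply (Equiv.injective _) _ _
  have h := (mul_right_cancel₀ hs (hc s)).trans (mul_right_cancel₀ ht (hc t)).symm
  rw [hds, hds, hti, htk] at h
  have hpow := mul_right_cancel₀ (pow_ne_zero _ (inv_ne_zero hζ0)) h
  rw [hζ.eq_orderOf]
  exact (hζ.isOfFinOrder hm).pow_eq_pow_iff_modEq.mp hpow

theorem exists_eq_single_of_coeff_ne_zero_of_projectively_invariant
    {C : MvPolynomial (Fin 5) ℂ} (hC : C.IsHomogeneous 3)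
    (hinv : ∀ g ∈ ShephardToddG 3 3 5, ∃ c : ℂ, ∀ x : Fin 5 → ℂ,
      eval (((g : GL (Fin 5) ℂ) : Matrix (Fin 5) (Fin 5) ℂ).mulVec x) C = c * eval x C)
    {s : Fin 5 →₀ ℕ} (hs : coeff s C ≠ 0) : ∃ i, s = Finsupp.single i 3 := by
  have hmod {i j k : Fin 5} (hik : i ≠ k) (hjk : j ≠ k) : s i ≡ s j [MOD 3] :=
    modEq_of_coeff_ne_zero_of_projectively_invariant three_ne_zero hinv hs hik hjk
  have hsum : ∑ i, s i = 3 := by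
    rw [← Finsupp.degree_eq_sum]
    by_contra h
    exact hs (hC.coeff_eq_zero h)
  have h01 := hmod (i := 0) (j := 1) (k := 2) (by decide) (by decide)
  have h02 := hmod (i := 0) (j := 2) (k := 1) (by decide) (by decide)
  have h03 := hmod (i := 0) (j := 3) (k := 1) (by decide) (by decide)
  have h04 := hmod (i := 0) (j := 4) (k := 1) (by decide) (by decide)
  rw [Fin.sum_univ_five] at hsum
  simp only [Nat.ModEq] at h01 h02 h03 h04
  obtain ⟨i, hi⟩ : ∃ i, s i = 3 := by
    by_contra! h
    have := h 0
    have := h 1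
    have := h 2
    have := h 3
    have := h 4
    omega
  refine ⟨i, Finsupp.ext fun l => ?_⟩
  by_cases hl : i = l
  · simp [← hl, hi]
  · have hle := Finset.sum_le_univ_sum_of_nonneg (s := {i, l}) (fun k => Nat.zero_le (s k))
    rw [Finset.sum_pair hl, Fin.sum_univ_five] at hle
    rw [Finsupp.single_eq_of_ne (Ne.symm hl)]
    omega

/-- If a homogeneous cubic `C ∈ ℂ[x₁,…,x₅]` is projectively invariant under
`G(3, 3, 5)` (for each `g` there is a scalar `c(g)` with
`C(g·x) = c(g)·C(x)` identically), then `C` is a scalar multiple of the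
Fermat cubic form `x₁³ + x₂³ + x₃³ + x₄³ + x₅³`. -/
theorem projectively_invariant_cubic_G335_is_fermat
    (C : MvPolynomial (Fin 5) ℂ) (hC : C.IsHomogeneous 3)
    (hinv : ∀ g ∈ ShephardToddG 3 3 5, ∃ c : ℂ, ∀ x : Fin 5 → ℂ,
      MvPolynomial.eval (((g : GL (Fin 5) ℂ) : Matrix (Fin 5) (Fin 5) ℂ).mulVec x) C =
        c * MvPolynomial.eval x C) :
    ∃ a : ℂ, C = MvPolynomial.C a * (∑ i : Fin 5, X i ^ 3) := by
  have hperm := exists_coeff_mapDomain_of_projectively_invariant hinv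
  have hswap (i j : Fin 5) : coeff (Finsupp.single i 3) C = coeff (Finsupp.single j 3) C := by
    by_cases hij : i = j
    · rw [hij]
    have hzero {a b : Fin 5} (h : coeff (Finsupp.single b 3) C = 0) :
        coeff (Finsupp.single a 3) C = 0 := by
      obtain ⟨c, hc⟩ := hperm (Equiv.swap a b)
      rw [hc, Finsupp.mapDomain_single, Equiv.swap_apply_left, h, mul_zero]
    obtain ⟨k, hki, hkj⟩ : ∃ k : Fin 5, k ≠ i ∧ k ≠ j := by
      revert i j; decide
    by_cases hk : coeff (Finsupp.single k 3) C = 0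
    · rw [hzero hk, hzero hk]
    obtain ⟨c, hc⟩ := hperm (Equiv.swap i j)
    have hck := hc (Finsupp.single k 3)
    rw [Finsupp.mapDomain_single, Equiv.swap_apply_of_ne_of_ne hki hkj] at hck
    have hc1 : c = 1 := (mul_eq_right₀ hk).mp hck.symm
    rw [hc, Finsupp.mapDomain_single, Equiv.swap_apply_left, hc1, one_mul]
  refine ⟨coeff (Finsupp.single 0 3) C, ?_⟩
  ext s
  simp only [coeff_C_mul, coeff_sum, coeff_X_pow]
  by_cases hs : ∃ i, s = Finsupp.single i 3
  · obtain ⟨i, rfl⟩ := hs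
    simp [Finsupp.single_left_inj, hswap i 0]
  · have h0 : coeff s C = 0 := by
      by_contra h
      exact hs (exists_eq_single_of_coeff_ne_zero_of_projectively_invariant hC hinv h)
    rw [h0, Finset.sum_eq_zero, mul_zero]
    intro i _
    exact if_neg fun h => hs ⟨i, h.symm⟩
end
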